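/- arXiv:2502.06577 — 8 statements merged into one kernel-verified Lean document; each statement's English description precedes it below -/
import Mathlib

section
/- For every finite DAG G = (V, E) and every subset U ⊆ V, the LSCA closure of U equals the set of nodes forming a Λ-structure over (U, U); that is, L∞(U) = Λ(U, U). -/
open scoped Classical

/-! ## Directed graphs, paths, ancestors -/

/-- A directed graph (given by its edge relation) is acyclic if no node is
reachable from itself by a non-trivial directed walk. -/
def Acyclic {V : Type} (E : V → V → Prop) : Prop :=
  ∀ v : V, ¬ Relation.TransGen E v v

/-- `IsPath E a b p` : the list `p` is a directed path from `a` to `b` in the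
graph with edge relation `E` (a path is a nonempty list of nodes in which each
node has an edge to the next; a single-node path is trivial). -/
def IsPath {V : Type} (E : V → V → Prop) (a b : V) (p : List V) : Prop :=
  p.Chain' E ∧ p.head? = some a ∧ p.getLast? = some b

/-- Descendants of `v` (every node is a descendant of itself). -/
def De {V : Type} (E : V → V → Prop) (v : V) : Set V :=
  {u | Relation.ReflTransGen E v u}

/-- Ancestors of `v` (every node is an ancestor of itself). -/
def An {V : Type} (E : V → V → Prop) (v : V) : Set V :=
  {u | Relation.ReflTransGen E u v}

/-- Parents of `v`. -/
def Pa {V : Type} (E : V → V → Prop) (v : V) : Set V :=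
  {p | E p v}

/-! ## Strict common ancestors, LSCAs, and the LSCA closure -/

/-- `v` is a strict common ancestor of `x` and `y` : there is a path from `v`
to `x` not containing `y`, and a path from `v` to `y` not containing `x`. -/
def SCA {V : Type} (E : V → V → Prop) (x y : V) : Set V :=
  {v | (∃ p, IsPath E v x p ∧ y ∉ p) ∧ (∃ p, IsPath E v y p ∧ x ∉ p)}

/-- `v` is a lowest strict common ancestor of `x` and `y` : it is a strict
common ancestor, and no strict common ancestor of `x,y` other than `v` is a
descendant of `v`. -/
def LSCApair {V : Type} (E : V → V → Prop) (x y : V) : Set V :=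
  {v | v ∈ SCA E x y ∧ ∀ w ∈ SCA E x y, w ≠ v → w ∉ De E v}

/-- The lowest strict common ancestors of a set `U` : nodes outside `U` that
are a lowest strict common ancestor of some pair of nodes of `U`. -/
def LSCAset {V : Type} (E : V → V → Prop) (U : Set V) : Set V :=
  {v | v ∉ U ∧ ∃ u ∈ U, ∃ u' ∈ U, v ∈ LSCApair E u u'}

/-- The `i`-th order LSCA set of `U`. -/
def lscaIter {V : Type} (E : V → V → Prop) (U : Set V) : ℕ → Set V
  | 0 => U
  | k + 1 => LSCAset E (lscaIter E U k) ∪ lscaIter E U k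

/-- The LSCA closure `L∞(U)` of `U`.  (The sets `lscaIter E U i` are increasing
in `i`, so on a finite node type this union equals `lscaIter E U k` for the
least `k` with `lscaIter E U k = lscaIter E U (k+1)`.) -/
def lscaClosure {V : Type} (E : V → V → Prop) (U : Set V) : Set V :=
  ⋃ k : ℕ, lscaIter E U k

/-! ## Λ-structures -/

/-- `(v, pa, pb)` is a Λ-structure over `(a, b)` : `pa` is a path from `v` to
`a`, `pb` is a path from `v` to `b`, and the two paths intersect only at `v`
(trivial paths are allowed). -/
def IsLambdaStruct {V : Type} (E : V → V → Prop) (v a b : V) (pa pb : List V) : Prop :=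
  IsPath E v a pa ∧ IsPath E v b pb ∧ ∀ w ∈ pa, w ∈ pb → w = v

/-- `Λ(U, W)` : the set of nodes forming a Λ-structure over `(U, W)`. -/
def LambdaSet {V : Type} (E : V → V → Prop) (U W : Set V) : Set V :=
  {v | ∃ u ∈ U, ∃ w ∈ W, ∃ pa pb : List V, IsLambdaStruct E v u w pa pb}

/-! ## Structural causal models -/

/-- A structural causal model over the graph with node type `V` and edge
relation `E` : each node `v` has a nonempty finite range `R v`, a nonempty
finite noise range `N v`, and a structural assignment `f v` computing the value
of `v` from the values of its parents and its noise value. -/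
structure SCM (V : Type) (E : V → V → Prop) where
  R : V → Type
  rFin : ∀ v, Finite (R v)
  rNe : ∀ v, Nonempty (R v)
  N : V → Type
  nFin : ∀ v, Finite (N v)
  nNe : ∀ v, Nonempty (N v)
  f : ∀ v : V, (∀ p : {p // E p v}, R p.1) → N v → R v

/-- Fuel-bounded approximation to the unrolled assignment. -/
noncomputable def approx {V : Type} {E : V → V → Prop} (scm : SCM V E)
    (n : ∀ v, scm.N v) : ℕ → ∀ v, scm.R v
  | 0 => fun v => (scm.rNe v).some
  | k + 1 => fun v => scm.f v (fun p => approx scm n k p.1) (n v)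

/-- The unrolled assignment `f̄_v(n)` of an SCM over an acyclic graph: the value
of `v` obtained by recursively composing the structural assignments of the
ancestors of `v`, evaluated at the unit `n`.  (On an acyclic graph every
directed path has fewer than `card V + 1` nodes, so this fuel value computes
the exact fixed point of the unrolling recursion
`f̄_v(n) = f_v((f̄_p(n))_{p ∈ Pa(v)}, n_v)`.) -/
noncomputable def unroll {V : Type} [Fintype V] {E : V → V → Prop} (scm : SCM V E)
    (n : ∀ v, scm.N v) (v : V) : scm.R v :=
  approx scm n (Fintype.card V + 1) v

/-- The atomic intervention `do(X = x)` : replace the structural assignment of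
`X` by the constant function with value `x`. -/
noncomputable def SCM.intervene {V : Type} {E : V → V → Prop} (scm : SCM V E)
    (X : V) (x : scm.R X) : SCM V E where
  R := scm.R
  rFin := scm.rFin
  rNe := scm.rNe
  N := scm.N
  nFin := scm.nFin
  nNe := scm.nNe
  f := fun v => if h : v = X then fun _ _ => h.symm ▸ x else scm.f v

/-- Fuel-bounded approximation to the blocked unrolled assignment. -/
noncomputable def blockApprox {V : Type} [Fintype V] {E : V → V → Prop} (scm : SCM V E)
    (B : V) (b : scm.R B) (n : ∀ v, scm.N v) : ℕ → ∀ v, scm.R v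
  | 0 => fun v =>
      if h : v = B then h.symm ▸ b
      else if Relation.ReflTransGen E B v then (scm.rNe v).some
      else unroll scm n v
  | k + 1 => fun v =>
      if h : v = B then h.symm ▸ b
      else if Relation.ReflTransGen E B v then
        scm.f v (fun p => blockApprox scm B b n k p.1) (n v)
      else unroll scm n v

/-- The blocked unrolled assignment `f̄_v[B](b, n)` : equal to `b` at `v = B`,
to the plain unrolled assignment `f̄_v(n)` if `v` is not a descendant of `B`,
and otherwise obtained by the unrolling recursion
`f̄_v[B](b,n) = f_v((f̄_p[B](b,n))_{p ∈ Pa(v)}, n_v)`. -/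
noncomputable def blockUnroll {V : Type} [Fintype V] {E : V → V → Prop} (scm : SCM V E)
    (B : V) (b : scm.R B) (n : ∀ v, scm.N v) (v : V) : scm.R v :=
  blockApprox scm B b n (Fintype.card V + 1) v

/-- The edge relation of the graph obtained after a conditional intervention on
`X` with conditioning set `A` : the parent set of `X` becomes `A`, and all
other edges are unchanged. -/
def condE {V : Type} (E : V → V → Prop) (X : V) (A : Set V) : V → V → Prop :=
  fun a b => (b = X ∧ a ∈ A) ∨ (b ≠ X ∧ E a b)

/-- The conditional intervention `do(X = g(A))` : replace the structural
assignment of `X` by the function that, given the values of the nodes in `A`,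
outputs `g` of those values, so that `A` becomes the parent set of `X`. -/
noncomputable def SCM.condIntervene {V : Type} {E : V → V → Prop} (scm : SCM V E)
    (X : V) (A : Set V) (g : (∀ a : A, scm.R a.1) → scm.R X) :
    SCM V (condE E X A) where
  R := scm.R
  rFin := scm.rFin
  rNe := scm.rNe
  N := scm.N
  nFin := scm.nFin
  nNe := scm.nNe
  f := fun v par nv =>
    if h : v = X then h.symm ▸ g (fun a => par ⟨a.1, Or.inl ⟨h, a.2⟩⟩)
    else scm.f v (fun p => par ⟨p.1, Or.inr ⟨h, p.2⟩⟩) nv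

/-! ## Interventional superiority -/

/-- `X` is (deterministically atomic-interventionally) superior to `W` relative
to `Y` : for every SCM over the graph in which the range of `Y` is linearly
ordered, and every unit `n`, there is `x ∈ R_X` such that for all `w ∈ R_W`,
`f̄_Y^{do(X=x)}(n) ≥ f̄_Y^{do(W=w)}(n)`. -/
def Superior {V : Type} [Fintype V] (E : V → V → Prop) (Y X W : V) : Prop :=
  ∀ (scm : SCM V E) (L : LinearOrder (scm.R Y)) (n : ∀ v, scm.N v),
    ∃ x : scm.R X, ∀ w : scm.R W,
      L.le (unroll (scm.intervene W w) n Y) (unroll (scm.intervene X x) n Y)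

/-- Superiority for sets of nodes: `S ≽_Y T` iff every node of `T` is inferior
to some node of `S`. -/
def SetSuperior {V : Type} [Fintype V] (E : V → V → Prop) (Y : V) (S T : Set V) : Prop :=
  ∀ W ∈ T, ∃ X ∈ S, Superior E Y X W

/-- A globally interventionally superior set (GISS) of the graph relative to
`Y` : a subset `U` of `V \ {Y}` with `U ≽_Y (V \ {Y}) \ U`. -/
def IsGISS {V : Type} [Fintype V] (E : V → V → Prop) (Y : V) (U : Set V) : Prop :=
  U ⊆ Set.univ \ {Y} ∧ SetSuperior E Y U ((Set.univ \ {Y}) \ U)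

/-- A minimal globally interventionally superior set (mGISS): a GISS that is
minimal with respect to set inclusion. -/
def IsMGISS {V : Type} [Fintype V] (E : V → V → Prop) (Y : V) (U : Set V) : Prop :=
  IsGISS E Y U ∧ ∀ U' : Set V, IsGISS E Y U' → U' ⊆ U → U' = U

/-! ## Reachability inside a set of nodes -/

/-- `ReachableIn E S a b` : there is a directed path from `a` to `b` all of whose nodes lie
in `S`. -/
inductive ReachableIn {V : Type} (E : V → V → Prop) (S : Set V) : V → V → Prop
  | refl {a : V} (ha : a ∈ S) : ReachableIn E S a a
  | head {a c b : V} (ha : a ∈ S) (hac : E a c) (hcb : ReachableIn E S c b) :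
      ReachableIn E S a b

namespace ReachableIn

variable {V : Type} {E : V → V → Prop} {S T : Set V} {a b c : V}

theorem mono (h : ReachableIn E S a b) (hST : S ⊆ T) : ReachableIn E T a b := by
  induction h with
  | refl ha => exact .refl (hST ha)
  | head ha hac _ ih => exact .head (hST ha) hac ih

theorem trans (h : ReachableIn E S a b) (h' : ReachableIn E S b c) : ReachableIn E S a c := by
  induction h with
  | refl _ => exact h'
  | head ha hac _ ih => exact .head ha hac (ih h')

theorem reflTransGen (h : ReachableIn E S a b) : Relation.ReflTransGen E a b := by
  induction h with
  | refl _ => exact .refl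
  | head _ hac _ ih => exact .head hac ih

theorem left_mem (h : ReachableIn E S a b) : a ∈ S := by
  cases h <;> assumption

theorem of_reflTransGen (h : Relation.ReflTransGen E a b) : ReachableIn E Set.univ a b := by
  induction h using Relation.ReflTransGen.head_induction_on with
  | refl => exact .refl trivial
  | head hac _ ih => exact .head trivial hac ih

theorem inter_De (h : ReachableIn E S a b) : ReachableIn E (S ∩ De E a) a b := by
  induction h with
  | refl ha => exact .refl ⟨ha, .refl⟩
  | head ha hac _ ih =>
    exact .head ⟨ha, .refl⟩ hac
      (ih.mono fun _ hx => ⟨hx.1, Relation.ReflTransGen.head hac hx.2⟩)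

/-- A path either avoids `T`, or has a first node in `T`. -/
theorem avoid_or_first (T : Set V) (h : ReachableIn E S a b) :
    ReachableIn E (S \ T) a b ∨ ∃ z ∈ S ∩ T, ReachableIn E (insert z (S \ T)) a z := by
  induction h with
  | @refl a ha =>
    by_cases hT : a ∈ T
    · exact .inr ⟨a, ⟨ha, hT⟩, .refl (.inl rfl)⟩
    · exact .inl (.refl ⟨ha, hT⟩)
  | @head a c b ha hac _ ih =>
    by_cases hT : a ∈ T
    · exact .inr ⟨a, ⟨ha, hT⟩, .refl (.inl rfl)⟩
    · rcases ih with h | ⟨z, hz, h⟩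
      · exact .inl (.head ⟨ha, hT⟩ hac h)
      · exact .inr ⟨z, hz, .head (.inr ⟨ha, hT⟩) hac h⟩

/-- A path either avoids `T`, or has a last node in `T`. -/
theorem avoid_or_last (T : Set V) (h : ReachableIn E S a b) :
    ReachableIn E (S \ T) a b ∨ ∃ z ∈ S ∩ T, ReachableIn E (insert z (S \ T)) z b := by
  induction h with
  | @refl a ha =>
    by_cases hT : a ∈ T
    · exact .inr ⟨a, ⟨ha, hT⟩, .refl (.inl rfl)⟩
    · exact .inl (.refl ⟨ha, hT⟩)
  | @head a c b ha hac _ ih =>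
    rcases ih with h | h
    · by_cases hT : a ∈ T
      · exact .inr ⟨a, ⟨ha, hT⟩, .head (.inl rfl) hac (h.mono (Set.subset_insert _ _))⟩
      · exact .inl (.head ⟨ha, hT⟩ hac h)
    · exact .inr h

theorem exists_isPath (h : ReachableIn E S a b) : ∃ p, IsPath E a b p ∧ ∀ x ∈ p, x ∈ S := by
  induction h with
  | @refl a ha => exact ⟨[a], ⟨List.isChain_singleton a, rfl, rfl⟩, by simpa using ha⟩
  | @head a c b ha hac _ ih =>
    obtain ⟨p, ⟨hp, hh, hl⟩, hS⟩ := ih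
    cases p with
    | nil => simp at hh
    | cons x t =>
      obtain rfl : x = c := by simpa using hh
      refine ⟨a :: x :: t, ⟨List.IsChain.cons_cons hac hp, rfl, ?_⟩, ?_⟩
      · simpa [List.getLast?_cons_cons] using hl
      · intro y hy
        rcases List.mem_cons.1 hy with rfl | hy
        · exact ha
        · exact hS y hy

end ReachableIn

namespace IsPath

variable {V : Type} {E : V → V → Prop}

theorem reachableIn_of_mem {p : List V} {a b z : V} (h : IsPath E a b p) (hz : z ∈ p) :
    ReachableIn E {x | x ∈ p} a z ∧ ReachableIn E {x | x ∈ p} z b := by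
  induction p generalizing a z with
  | nil => simp at hz
  | cons x t ih =>
    obtain ⟨hc, hh, hl⟩ := h
    obtain rfl : x = a := by simpa using hh
    cases t with
    | nil =>
      obtain rfl : x = b := by simpa using hl
      obtain rfl : z = x := by simpa using hz
      exact ⟨.refl (by simp), .refl (by simp)⟩
    | cons y t =>
      have hxy : E x y := (List.isChain_cons_cons.1 hc).1
      have hy : IsPath E y b (y :: t) :=
        ⟨(List.isChain_cons_cons.1 hc).2, rfl, by simpa [List.getLast?_cons_cons] using hl⟩
      have hsub : {w | w ∈ y :: t} ⊆ {w | w ∈ x :: y :: t} := fun _ hw =>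
        List.mem_cons_of_mem _ hw
      have hx : x ∈ {w | w ∈ x :: y :: t} := List.mem_cons_self
      rcases List.mem_cons.1 hz with rfl | hz
      · exact ⟨.refl hx, .head hx hxy ((ih hy List.mem_cons_self).2.mono hsub)⟩
      · obtain ⟨h₁, h₂⟩ := ih hy hz
        exact ⟨.head hx hxy (h₁.mono hsub), h₂.mono hsub⟩

theorem left_mem {p : List V} {a b : V} (h : IsPath E a b p) : a ∈ p :=
  List.mem_of_mem_head? h.2.1

theorem right_mem {p : List V} {a b : V} (h : IsPath E a b p) : b ∈ p :=
  List.mem_of_getLast? h.2.2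

theorem reachableIn {p : List V} {a b : V} (h : IsPath E a b p) :
    ReachableIn E {x | x ∈ p} a b :=
  (h.reachableIn_of_mem h.left_mem).2

end IsPath

section

variable {V : Type} {E : V → V → Prop}

/-! ## The ancestor order -/

theorem Acyclic.antisymm (hacy : Acyclic E) {a b : V} (hab : Relation.ReflTransGen E a b)
    (hba : Relation.ReflTransGen E b a) : a = b := by
  rcases Relation.reflTransGen_iff_eq_or_transGen.1 hab with h | h
  · exact h.symm
  · exact absurd (h.trans_left hba) (hacy a)

theorem Acyclic.ncard_An_lt [Finite V] (hacy : Acyclic E) {a b : V}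
    (hab : Relation.ReflTransGen E a b) (hne : a ≠ b) : (An E a).ncard < (An E b).ncard := by
  refine Set.ncard_lt_ncard ⟨fun x hx => Relation.ReflTransGen.trans hx hab, fun h => ?_⟩
    (Set.toFinite _)
  exact hne (hacy.antisymm hab (h (show b ∈ An E b from .refl)))

/-! ## Λ-structures -/

theorem LambdaSet.of_reachableIn {U W S T : Set V} {v a b : V} (ha : a ∈ U) (hb : b ∈ W)
    (hS : ReachableIn E S v a) (hT : ReachableIn E T v b) (h : ∀ x ∈ S, x ∈ T → x = v) :
    v ∈ LambdaSet E U W := by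
  obtain ⟨p, hp, hpS⟩ := hS.exists_isPath
  obtain ⟨q, hq, hqT⟩ := hT.exists_isPath
  exact ⟨a, ha, b, hb, p, q, hp, hq, fun x hx hx' => h x (hpS x hx) (hqT x hx')⟩

theorem LambdaSet.symm {U W : Set V} {v : V} (h : v ∈ LambdaSet E U W) :
    v ∈ LambdaSet E W U := by
  obtain ⟨a, ha, b, hb, p, q, hp, hq, hpq⟩ := h
  exact ⟨b, hb, a, ha, q, p, hq, hp, fun x hx hx' => hpq x hx' hx⟩

theorem LambdaSet.mono {U U' W W' : Set V} (hU : U ⊆ U') (hW : W ⊆ W') :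
    LambdaSet E U W ⊆ LambdaSet E U' W' :=
  fun _ ⟨a, ha, b, hb, h⟩ => ⟨a, hU ha, b, hW hb, h⟩

theorem subset_LambdaSet (U : Set V) : U ⊆ LambdaSet E U U := fun v hv =>
  LambdaSet.of_reachableIn hv hv (.refl (Set.mem_singleton v)) (.refl (Set.mem_singleton v))
    fun _ hx _ => hx

/-- If the first path meets the leg `C` of a second Λ-structure at `z`, before meeting the other
leg `D`, it can be rerouted along `C`. -/
theorem LambdaSet.reroute (hacy : Acyclic E) {U : Set V} {v x y c d z : V} {p q pc pd : List V}
    (hc : c ∈ U) (hd : d ∈ U) (hpq : IsLambdaStruct E v x y p q)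
    (hcd : IsLambdaStruct E y c d pc pd) (hy : y ≠ v) (hzp : z ∈ p) (hzc : z ∈ pc)
    (hz : ReachableIn E (insert z ({w | w ∈ p} \ ({w | w ∈ pc} ∪ {w | w ∈ pd}))) v z) :
    v ∈ LambdaSet E U U := by
  obtain ⟨-, hq, hpq⟩ := hpq
  obtain ⟨hpc, hpd, hcd⟩ := hcd
  have hzy : ¬ Relation.ReflTransGen E z y := fun h => by
    obtain rfl := hacy.antisymm h (hpc.reachableIn_of_mem hzc).1.reflTransGen
    exact hy (hpq _ hzp hq.right_mem)
  have hzc' := (hpc.reachableIn_of_mem hzc).2.inter_De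
  refine LambdaSet.of_reachableIn hc hd
    ((hz.mono (Set.subset_union_left (t := {w | w ∈ pc} ∩ De E z))).trans
      (hzc'.mono Set.subset_union_right))
    ((hq.reachableIn.mono (Set.subset_union_left (t := {w | w ∈ pd}))).trans
      (hpd.reachableIn.mono Set.subset_union_right)) ?_
  have key : ∀ w, w ∈ pc → Relation.ReflTransGen E z w → w ∈ q ∨ w ∈ pd → w = v := by
    intro w hw hzw hw'
    suffices w = y from absurd (this ▸ hzw) hzy
    rcases hw' with hw' | hw'
    · exact hacy.antisymm (hq.reachableIn_of_mem hw').2.reflTransGen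
        (hpc.reachableIn_of_mem hw).1.reflTransGen
    · exact hcd w hw hw'
  rintro w ((rfl | ⟨hwp, hwT⟩) | ⟨hwc, hzw⟩) hw
  · exact key w hzc .refl hw
  · rcases hw with hw | hw
    · exact hpq w hwp hw
    · exact absurd (.inr hw) hwT
  · exact key w hwc hzw hw

theorem LambdaSet.compose (hacy : Acyclic E) {X U : Set V} {v : V}
    (hv : v ∈ LambdaSet E X (LambdaSet E U U)) : v ∈ LambdaSet E (X ∪ U) U := by
  obtain ⟨x, hx, y, ⟨c, hc, d, hd, pc, pd, hcd⟩, p, q, hpq⟩ := hv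
  have hUU : LambdaSet E U U ⊆ LambdaSet E (X ∪ U) U :=
    LambdaSet.mono Set.subset_union_right subset_rfl
  by_cases hy : y = v
  · exact hUU (hy ▸ ⟨c, hc, d, hd, pc, pd, hcd⟩)
  rcases hpq.1.reachableIn.avoid_or_first ({w | w ∈ pc} ∪ {w | w ∈ pd}) with
    h | ⟨z, ⟨hzp, hzc | hzd⟩, hz⟩
  · refine LambdaSet.of_reachableIn (.inl hx) hc h
      ((hpq.2.1.reachableIn.mono (Set.subset_union_left (t := {w | w ∈ pc}))).trans
        (hcd.1.reachableIn.mono Set.subset_union_right)) ?_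
    rintro w ⟨hwp, hwT⟩ (hw | hw)
    · exact hpq.2.2 w hwp hw
    · exact absurd (.inl hw) hwT
  · exact hUU (LambdaSet.reroute hacy hc hd hpq hcd hy hzp hzc hz)
  · rw [Set.union_comm] at hz
    exact hUU (LambdaSet.reroute hacy hd hc hpq
      ⟨hcd.2.1, hcd.1, fun w hw hw' => hcd.2.2 w hw' hw⟩ hy hzp hzd hz)

theorem LambdaSet.idem (hacy : Acyclic E) (U : Set V) :
    LambdaSet E (LambdaSet E U U) (LambdaSet E U U) ⊆ LambdaSet E U U := by
  rintro v ⟨x, hx, y, hy, h⟩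
  have h₁ : v ∈ LambdaSet E ({x} ∪ U) U := LambdaSet.compose hacy ⟨x, rfl, y, hy, h⟩
  have hsub : {x} ∪ U ⊆ LambdaSet E U U :=
    Set.union_subset (Set.singleton_subset_iff.2 hx) (subset_LambdaSet U)
  simpa using LambdaSet.compose hacy (LambdaSet.mono subset_rfl hsub (LambdaSet.symm h₁))

/-! ## Lowest strict common ancestors -/

theorem LSCApair.mem_LambdaSet {x y v : V} {W : Set V} (hx : x ∈ W) (hy : y ∈ W)
    (hv : v ∈ LSCApair E x y) : v ∈ LambdaSet E W W := by
  obtain ⟨⟨⟨p, hp, hyp⟩, q, hq, hxq⟩, hlow⟩ := hv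
  refine ⟨x, hx, y, hy, p, q, hp, hq, fun w hwp hwq => ?_⟩
  obtain ⟨hvw, hwx⟩ := hp.reachableIn_of_mem hwp
  obtain ⟨p', hp', hpp'⟩ := hwx.exists_isPath
  obtain ⟨q', hq', hqq'⟩ := (hq.reachableIn_of_mem hwq).2.exists_isPath
  by_contra hne
  exact hlow w ⟨⟨p', hp', fun h => hyp (hpp' y h)⟩, q', hq', fun h => hxq (hqq' x h)⟩ hne
    hvw.reflTransGen

theorem lscaClosure_subset_LambdaSet (hacy : Acyclic E) (U : Set V) :
    lscaClosure E U ⊆ LambdaSet E U U := by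
  refine Set.iUnion_subset fun k => ?_
  induction k with
  | zero => exact subset_LambdaSet U
  | succ k ih =>
    rintro v (⟨-, x, hx, y, hy, hv⟩ | hv)
    · exact LambdaSet.idem hacy U (LSCApair.mem_LambdaSet (ih hx) (ih hy) hv)
    · exact ih hv

theorem lscaIter_mono (U : Set V) : Monotone (lscaIter E U) :=
  monotone_nat_of_le_succ fun _ => Set.subset_union_right

theorem LSCApair.mem_lscaClosure {U : Set V} {a b v : V} (ha : a ∈ lscaClosure E U)
    (hb : b ∈ lscaClosure E U) (hv : v ∈ LSCApair E a b) : v ∈ lscaClosure E U := by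
  obtain ⟨i, hi⟩ := Set.mem_iUnion.1 ha
  obtain ⟨j, hj⟩ := Set.mem_iUnion.1 hb
  refine Set.mem_iUnion.2 ⟨max i j + 1, ?_⟩
  by_cases h : v ∈ lscaIter E U (max i j)
  · exact .inr h
  · exact .inl ⟨h, a, lscaIter_mono U (le_max_left i j) hi, b,
      lscaIter_mono U (le_max_right i j) hj, hv⟩

/-- Every strict common ancestor has a descendant that is a lowest one. -/
theorem SCA.exists_LSCApair [Finite V] (hacy : Acyclic E) {a b v : V} (hv : v ∈ SCA E a b) :
    ∃ w ∈ LSCApair E a b, Relation.ReflTransGen E v w := by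
  obtain ⟨w, ⟨hw, hvw⟩, hmax⟩ := Set.exists_max_image (SCA E a b ∩ De E v)
    (fun w => (An E w).ncard) (Set.toFinite _) ⟨v, hv, .refl⟩
  refine ⟨w, ⟨hw, fun w' hw' hne hww' => ?_⟩, hvw⟩
  exact (hacy.ncard_An_lt hww' hne.symm).not_ge
    (hmax w' ⟨hw', Relation.ReflTransGen.trans hvw hww'⟩)

theorem IsLambdaStruct.mem_lscaClosure [Finite V] (hacy : Acyclic E) {U : Set V} {v a b : V}
    {p q : List V} (ha : a ∈ lscaClosure E U) (hb : b ∈ lscaClosure E U)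
    (h : IsLambdaStruct E v a b p q) : v ∈ lscaClosure E U := by
  induction hn : (An E a).ncard + (An E b).ncard using Nat.strong_induction_on
    generalizing a b p q with
  | _ n ih =>
    subst hn
    by_contra hvL
    obtain ⟨hp, hq, hpq⟩ := h
    have hv : v ∈ SCA E a b :=
      ⟨⟨p, hp, fun hbp => hvL (hpq b hbp hq.right_mem ▸ hb)⟩,
        q, hq, fun haq => hvL (hpq a hp.right_mem haq ▸ ha)⟩
    obtain ⟨w, hw, hvw⟩ := SCA.exists_LSCApair hacy hv
    have hwL : w ∈ lscaClosure E U := LSCApair.mem_lscaClosure ha hb hw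
    obtain ⟨⟨⟨pa, hpa, hbpa⟩, pb, hpb, hapb⟩, -⟩ := hw
    have hwa : (An E w).ncard < (An E a).ncard :=
      hacy.ncard_An_lt hpa.reachableIn.reflTransGen fun h => hapb (h ▸ hpb.left_mem)
    have hwb : (An E w).ncard < (An E b).ncard :=
      hacy.ncard_An_lt hpb.reachableIn.reflTransGen fun h => hbpa (h ▸ hpa.left_mem)
    rcases (ReachableIn.of_reflTransGen hvw).avoid_or_last ({x | x ∈ p} ∪ {x | x ∈ q}) with
      h | ⟨z, ⟨-, hzp | hzq⟩, hz⟩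
    · exact h.left_mem.2 (.inl hp.left_mem)
    · obtain ⟨r, hr, hrS⟩ := (((hp.reachableIn_of_mem hzp).1.mono Set.subset_union_left).trans
        (hz.mono (Set.subset_union_right (s := {x | x ∈ p})))).exists_isPath
      refine hvL (ih _ (Nat.add_lt_add_right hwa _) hwL hb ⟨hr, hq, fun x hx hxq => ?_⟩ rfl)
      rcases hrS x hx with hxp | rfl | hxT
      · exact hpq x hxp hxq
      · exact hpq x hzp hxq
      · exact absurd (.inr hxq) hxT.2
    · obtain ⟨r, hr, hrS⟩ := (((hq.reachableIn_of_mem hzq).1.mono Set.subset_union_left).trans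
        (hz.mono (Set.subset_union_right (s := {x | x ∈ q})))).exists_isPath
      refine hvL (ih _ (Nat.add_lt_add_left hwb _) ha hwL ⟨hp, hr, fun x hxp hx => ?_⟩ rfl)
      rcases hrS x hx with hxq | rfl | hxT
      · exact hpq x hxp hxq
      · exact hpq x hxp hzq
      · exact absurd (.inl hxp) hxT.2

end


/-- For every finite DAG `G = (V, E)` and every subset
`U ⊆ V`, the LSCA closure of `U` equals the set of nodes forming a Λ-structure
over `(U, U)`: `L∞(U) = Λ(U, U)`. -/
theorem lscaClosure_eq_lambdaSet {V : Type} [Fintype V] (E : V → V → Prop)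
    (hacy : Acyclic E) (U : Set V) :
    lscaClosure E U = LambdaSet E U U := by
  refine (lscaClosure_subset_LambdaSet hacy U).antisymm ?_
  rintro v ⟨a, ha, b, hb, p, q, h⟩
  have hU : U ⊆ lscaClosure E U := Set.subset_iUnion (lscaIter E U) 0
  exact h.mem_lscaClosure hacy (hU ha) (hU hb)
end

section
/- For every finite DAG G = (V, E) and all subsets U', U ⊆ V, if U' ⊆ U then L∞(U') ⊆ L∞(U). -/
open scoped Classical

/-- The iterated LSCA sets of `U` increase with the order. -/
theorem lscaIter_monotone {V : Type} (E : V → V → Prop) (U : Set V) :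
    Monotone (lscaIter E U) :=
  monotone_nat_of_le_succ fun _ => Set.subset_union_right

/-- The LSCA closure contains every lowest strict common ancestor of two of its nodes. -/
theorem LSCApair_subset_lscaClosure {V : Type} (E : V → V → Prop) (U : Set V) {x y : V}
    (hx : x ∈ lscaClosure E U) (hy : y ∈ lscaClosure E U) :
    LSCApair E x y ⊆ lscaClosure E U := by
  intro v hv
  obtain ⟨m, hm⟩ := Set.mem_iUnion.mp hx
  obtain ⟨n, hn⟩ := Set.mem_iUnion.mp hy
  have hmx := lscaIter_monotone E U (le_max_left m n) hm
  have hny := lscaIter_monotone E U (le_max_right m n) hn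
  refine Set.mem_iUnion.mpr ⟨max m n + 1, ?_⟩
  by_cases h : v ∈ lscaIter E U (max m n)
  · exact Or.inr h
  · exact Or.inl ⟨h, x, hmx, y, hny, hv⟩

/-- For every finite DAG `G = (V, E)` and all subsets
`U', U ⊆ V`, if `U' ⊆ U` then `L∞(U') ⊆ L∞(U)`. -/
theorem lscaClosure_mono {V : Type} [Fintype V] (E : V → V → Prop)
    (hacy : Acyclic E) (U' U : Set V) (hsub : U' ⊆ U) :
    lscaClosure E U' ⊆ lscaClosure E U := by
  refine Set.iUnion_subset fun k => ?_
  induction k with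
  | zero => exact hsub.trans (Set.subset_iUnion (lscaIter E U) 0)
  | succ k ih =>
    refine Set.union_subset ?_ ih
    rintro v ⟨-, x, hx, y, hy, hv⟩
    exact LSCApair_subset_lscaClosure E U (ih hx) (ih hy) hv
end

section
/- For every finite DAG G = (V, E) and every subset U ⊆ V, every node v ∈ LSCA(U) forms a Λ-structure over (U, U); that is, LSCA(U) ⊆ Λ(U, U). -/
open scoped Classical

theorem IsPath.drop_until {V : Type} {E : V → V → Prop} {a b w : V} {p : List V}
    (hp : IsPath E a b p) (hw : w ∈ p) :
    w ∈ De E a ∧ ∃ q, IsPath E w b q ∧ q ⊆ p := by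
  obtain ⟨hc, hh, hl⟩ := hp
  obtain ⟨s, t, rfl⟩ := List.append_of_mem hw
  refine ⟨?_, w :: t, ⟨List.IsChain.right_of_append hc, rfl, ?_⟩,
    List.subset_append_right s _⟩
  · cases s with
    | nil =>
      obtain rfl : w = a := by simpa using hh
      exact Relation.ReflTransGen.refl
    | cons x s =>
      obtain rfl : x = a := by simpa using hh
      have hd : (x :: (s ++ w :: t)).Pairwise (Relation.TransGen E) :=
        List.isChain_iff_pairwise.mp
          (List.IsChain.imp (fun _ _ h => Relation.TransGen.single h) hc)
      exact ((List.pairwise_cons.mp hd).1 w (by simp)).to_reflTransGen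
  · simpa [List.getLast?_append] using hl

/-- For every finite DAG `G = (V, E)` and every subset
`U ⊆ V`, every node `v ∈ LSCA(U)` forms a Λ-structure over `(U, U)`:
`LSCA(U) ⊆ Λ(U, U)`. -/
theorem lscaSet_subset_lambdaSet {V : Type} [Fintype V] (E : V → V → Prop)
    (hacy : Acyclic E) (U : Set V) :
    LSCAset E U ⊆ LambdaSet E U U := by
  rintro v ⟨-, x, hx, y, hy, ⟨⟨p, hp, hyp⟩, q, hq, hxq⟩, hlow⟩
  refine ⟨x, hx, y, hy, p, q, hp, hq, fun w hwp hwq => ?_⟩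
  by_contra hwv
  obtain ⟨hvw, p', hp', hpp⟩ := hp.drop_until hwp
  obtain ⟨-, q', hq', hqq⟩ := hq.drop_until hwq
  exact hlow w ⟨⟨p', hp', fun h => hyp (hpp h)⟩, q', hq', fun h => hxq (hqq h)⟩ hwv hvw
end

section
/- Let G = (V, E) be a finite DAG, let b1, b2 ∈ V with b1 ≠ b2, let v ∈ V with v ∉ {b1, b2}, and let π1 be a path from v to b1 and π2 a path from v to b2 such that b1 ∉ π2 and b2 ∉ π1 (other overlaps between π1 and π2 are allowed). Then there exists a node v' ∈ π1 ∩ π2 such that the suffix of π1 starting at v' and the suffix of π2 starting at v' intersect only at v'; in particular, (v', π1|^{v'}, π2|^{v'}) is a Λ-structure over (b1, b2). -/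
open scoped Classical

/-- A node `w` of a path splits off a suffix of that path starting at `w`, and this suffix is
strictly shorter unless `w` is the start of the path. -/
theorem IsPath.exists_suffix {V : Type} {E : V → V → Prop} {a b w : V} {p : List V}
    (hp : IsPath E a b p) (hw : w ∈ p) :
    ∃ s, s <:+ p ∧ IsPath E w b s ∧ (w ≠ a → s.length < p.length) := by
  obtain ⟨l, t, rfl⟩ := List.append_of_mem hw
  obtain ⟨hc, hh, hl⟩ := hp
  refine ⟨w :: t, List.suffix_append l _, ⟨hc.suffix (List.suffix_append l _), rfl, ?_⟩, ?_⟩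
  · simpa [List.getLast?_append] using hl
  · intro hne
    cases l with
    | nil => exact absurd (by simpa using hh) hne
    | cons x l => simp

theorem IsPath.start_mem {V : Type} {E : V → V → Prop} {a b : V} {p : List V}
    (hp : IsPath E a b p) : a ∈ p :=
  List.mem_of_mem_head? hp.2.1

/-- Two paths with a common start have suffixes that form a Λ-structure. -/
theorem IsPath.exists_lambdaStruct {V : Type} {E : V → V → Prop} {v a b : V} {p q : List V}
    (hp : IsPath E v a p) (hq : IsPath E v b q) :
    ∃ v' s t, s <:+ p ∧ t <:+ q ∧ IsLambdaStruct E v' a b s t := by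
  induction hn : p.length using Nat.strong_induction_on generalizing v p q with
  | _ n ih =>
    by_cases h : ∀ w ∈ p, w ∈ q → w = v
    · exact ⟨v, p, q, List.suffix_rfl, List.suffix_rfl, hp, hq, h⟩
    · push Not at h
      obtain ⟨w, hwp, hwq, hne⟩ := h
      obtain ⟨p', hp'p, hp', hlt⟩ := hp.exists_suffix hwp
      obtain ⟨q', hq'q, hq', -⟩ := hq.exists_suffix hwq
      obtain ⟨v', s, t, hs, ht, hst⟩ := ih _ (hn ▸ hlt hne) hp' hq' rfl
      exact ⟨v', s, t, hs.trans hp'p, ht.trans hq'q, hst⟩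

/-- Existence of a Λ-substructure: given a finite DAG, nodes
`b₁ ≠ b₂`, a node `v ∉ {b₁, b₂}`, and paths `π₁ : v ⇢ b₁`, `π₂ : v ⇢ b₂` with
`b₁ ∉ π₂` and `b₂ ∉ π₁` (other overlaps allowed), there is a node
`v' ∈ π₁ ∩ π₂` such that the suffix of `π₁` starting at `v'` and the suffix of
`π₂` starting at `v'` intersect only at `v'`; in particular
`(v', π₁|^{v'}, π₂|^{v'})` is a Λ-structure over `(b₁, b₂)`. -/
theorem exists_lambda_substructure {V : Type} [Fintype V] (E : V → V → Prop)
    (hacy : Acyclic E) (b₁ b₂ v : V) (hb : b₁ ≠ b₂)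
    (hv₁ : v ≠ b₁) (hv₂ : v ≠ b₂)
    (π₁ π₂ : List V) (h₁ : IsPath E v b₁ π₁) (h₂ : IsPath E v b₂ π₂)
    (hb₁ : b₁ ∉ π₂) (hb₂ : b₂ ∉ π₁) :
    ∃ v' : V, v' ∈ π₁ ∧ v' ∈ π₂ ∧
      ∃ s₁ s₂ : List V, s₁ <:+ π₁ ∧ s₂ <:+ π₂ ∧
        IsLambdaStruct E v' b₁ b₂ s₁ s₂ := by
  obtain ⟨v', s, t, hs, ht, hst⟩ := h₁.exists_lambdaStruct h₂
  exact ⟨v', hs.subset hst.1.start_mem, ht.subset hst.2.1.start_mem, s, t, hs, ht, hst⟩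
end

section
/- Let G = (V, E) be a finite DAG, let Y ∈ V, and let B be a proper ancestor of Y (B ∈ An(Y), B ≠ Y) with B ∉ L∞(Pa(Y)). Then there is exactly one node Z ∈ L∞(Pa(Y)) such that there exists a non-trivial path from B to Z none of whose nodes other than Z lies in L∞(Pa(Y)). -/
open scoped Classical

/-- `Connects E U a z`: the node `z` lies in `U` and is reached from `a` by a directed path all of
whose nodes other than `z` lie outside `U`. -/
def Connects {V : Type} (E : V → V → Prop) (U : Set V) (a z : V) : Prop :=
  z ∈ U ∧ Relation.ReflTransGen (fun x y => x ∉ U ∧ E x y) a z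

theorem exists_isPath_forall_ne_iff {V : Type} {E : V → V → Prop} {Q : V → Prop} {a b : V} :
    (∃ p, IsPath E a b p ∧ ∀ w ∈ p, w ≠ b → Q w) ↔
      Relation.ReflTransGen (fun x y => Q x ∧ E x y) a b := by
  constructor
  · rintro ⟨p, ⟨hchain, hhead, hlast⟩, hQ⟩
    induction p generalizing a with
    | nil => simp at hhead
    | cons c p ih =>
      obtain rfl : c = a := by simpa using hhead
      by_cases hcb : c = b
      · rw [hcb]
      · cases p with
        | nil => exact absurd (by simpa using hlast) hcb
        | cons d p =>
          obtain ⟨hcd, hchain⟩ := List.isChain_cons_cons.1 hchain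
          exact .head ⟨hQ c (by simp) hcb, hcd⟩
            (ih (fun w hw => hQ w (List.mem_cons_of_mem _ hw)) hchain rfl (by simpa using hlast))
  · intro h
    induction h using Relation.ReflTransGen.head_induction_on with
    | refl => exact ⟨[b], ⟨List.isChain_singleton _, rfl, rfl⟩, by simp⟩
    | @head a c hac _ ih =>
      obtain ⟨p, ⟨hchain, hhead, hlast⟩, hQ⟩ := ih
      cases p with
      | nil => simp at hhead
      | cons d p =>
        obtain rfl : d = c := by simpa using hhead
        refine ⟨a :: d :: p, ⟨List.isChain_cons_cons.2 ⟨hac.2, hchain⟩, rfl, by simpa using hlast⟩,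
          fun w hw hwb => ?_⟩
        rcases List.mem_cons.1 hw with rfl | hw
        · exact hac.1
        · exact hQ w hw hwb

theorem exists_isPath_notMem_iff {V : Type} {E : V → V → Prop} {v x y : V} :
    (∃ p, IsPath E v x p ∧ y ∉ p) ↔
      x ≠ y ∧ Relation.ReflTransGen (fun a b => a ≠ y ∧ E a b) v x := by
  rw [← exists_isPath_forall_ne_iff]
  constructor
  · rintro ⟨p, hp, hy⟩
    exact ⟨fun h => hy (h ▸ List.mem_of_getLast? hp.2.2),
      p, hp, fun w hw _ h => hy (h ▸ hw)⟩
  · rintro ⟨hxy, p, hp, hQ⟩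
    exact ⟨p, hp, fun hy => hQ y hy hxy.symm rfl⟩

theorem Connects.exists_of_reflTransGen {V : Type} {E R : V → V → Prop} {U : Set V}
    (hRE : ∀ x y, R x y → E x y) {a z : V} (h : Relation.ReflTransGen R a z) (hz : z ∈ U) :
    ∃ u, Connects E U a u ∧ Relation.ReflTransGen R u z := by
  induction h using Relation.ReflTransGen.head_induction_on with
  | refl => exact ⟨z, ⟨hz, .refl⟩, .refl⟩
  | @head a c hac hcz ih =>
    by_cases ha : a ∈ U
    · exact ⟨a, ⟨ha, .refl⟩, .head hac hcz⟩
    · obtain ⟨u, hu, huz⟩ := ih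
      exact ⟨u, ⟨hu.1, .head ⟨ha, hRE _ _ hac⟩ hu.2⟩, huz⟩

theorem Connects.eq_of_mem {V : Type} {E : V → V → Prop} {U : Set V} {a z : V}
    (h : Connects E U a z) (ha : a ∈ U) : a = z := by
  rcases h.2.cases_head with h | ⟨c, hac, _⟩
  · exact h
  · exact absurd ha hac.1

theorem Connects.reflTransGen {V : Type} {E : V → V → Prop} {U : Set V} {a z : V}
    (h : Connects E U a z) : Relation.ReflTransGen E a z :=
  Relation.ReflTransGen.mono (fun _ _ h => h.2) _ _ h.2

theorem Connects.mem_SCA {V : Type} {E : V → V → Prop} {U : Set V} {v x y : V}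
    (hx : Connects E U v x) (hy : Connects E U v y) (hxy : x ≠ y) : v ∈ SCA E x y :=
  ⟨exists_isPath_notMem_iff.2
    ⟨hxy, Relation.ReflTransGen.mono (fun _ _ h => ⟨fun e => h.1 (e ▸ hy.1), h.2⟩) _ _ hx.2⟩,
   exists_isPath_notMem_iff.2
    ⟨hxy.symm, Relation.ReflTransGen.mono (fun _ _ h => ⟨fun e => h.1 (e ▸ hx.1), h.2⟩) _ _ hy.2⟩⟩

theorem Acyclic.wellFounded_transGen {V : Type} [Finite V] {E : V → V → Prop} (h : Acyclic E) :
    WellFounded (Relation.TransGen E) :=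
  haveI : Std.Irrefl (Relation.TransGen E) := ⟨h⟩
  Finite.wellFounded_of_trans_of_irrefl _

theorem Acyclic.wellFounded_flip_transGen {V : Type} [Finite V] {E : V → V → Prop}
    (h : Acyclic E) : WellFounded (flip (Relation.TransGen E)) :=
  haveI : Std.Irrefl (flip (Relation.TransGen E)) := ⟨h⟩
  haveI : IsTrans V (flip (Relation.TransGen E)) := ⟨fun _ _ _ hab hbc => hbc.trans hab⟩
  Finite.wellFounded_of_trans_of_irrefl _

/-- If `U` contains all lowest strict common ancestors of its pairs, then every node is connected
to at most one node of `U`. -/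
theorem Connects.unique {V : Type} [Finite V] {E : V → V → Prop} (hacy : Acyclic E) {U : Set V}
    (hU : LSCAset E U ⊆ U) {v x y : V} (hx : Connects E U v x) (hy : Connects E U v y) :
    x = y := by
  induction v using hacy.wellFounded_flip_transGen.induction generalizing x y with
  | _ v ih =>
    by_cases hv : v ∈ U
    · exact (hx.eq_of_mem hv).symm.trans (hy.eq_of_mem hv)
    by_contra hxy
    obtain ⟨z, hz, hzmin⟩ := hacy.wellFounded_transGen.has_min {z | Connects E U v z} ⟨x, hx⟩
    obtain ⟨z', hz', hne⟩ : ∃ z', Connects E U v z' ∧ z ≠ z' := by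
      by_cases hzx : z = x
      · exact ⟨y, hy, hzx ▸ hxy⟩
      · exact ⟨x, hx, hzx⟩
    have hnot : v ∉ LSCApair E z z' := fun h => hv (hU ⟨hv, z, hz.1, z', hz'.1, h⟩)
    obtain ⟨w, hw, hwv, hvw⟩ : ∃ w ∈ SCA E z z', w ≠ v ∧ w ∈ De E v := by
      by_contra! h
      exact hnot ⟨hz.mem_SCA hz' hne, h⟩
    have hvw' : Relation.TransGen E v w :=
      (Relation.reflTransGen_iff_eq_or_transGen.1 hvw).resolve_left hwv
    obtain ⟨-, hwz⟩ := exists_isPath_notMem_iff.1 hw.1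
    obtain ⟨-, hwz'⟩ := exists_isPath_notMem_iff.1 hw.2
    obtain ⟨u, hu, huz⟩ := Connects.exists_of_reflTransGen (E := E) (fun _ _ h => h.2) hwz hz.1
    obtain ⟨u', hu', huz'⟩ :=
      Connects.exists_of_reflTransGen (E := E) (fun _ _ h => h.2) hwz' hz'.1
    obtain rfl : u = u' := ih w hvw' hu hu'
    have hu_ne : z ≠ u := by
      rcases huz'.cases_head with h | ⟨c, huc, _⟩
      · exact h ▸ hne
      · exact huc.1.symm
    have huz_lt : Relation.TransGen E u z :=
      (Relation.reflTransGen_iff_eq_or_transGen.1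
        (Relation.ReflTransGen.mono (fun _ _ h => h.2) _ _ huz)).resolve_left hu_ne
    obtain ⟨d, hd, hdu⟩ := Connects.exists_of_reflTransGen (E := E) (fun _ _ h => h)
      (hvw.trans hu.reflTransGen) hu.1
    exact hzmin d hd (.trans_right hdu huz_lt)

theorem LSCAset_lscaClosure_subset {V : Type} (E : V → V → Prop) (U : Set V) :
    LSCAset E (lscaClosure E U) ⊆ lscaClosure E U := by
  rintro v ⟨hv, x, hx, y, hy, hxy⟩
  obtain ⟨i, hi⟩ := Set.mem_iUnion.1 hx
  obtain ⟨j, hj⟩ := Set.mem_iUnion.1 hy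
  refine Set.mem_iUnion.2 ⟨max i j + 1, Or.inl ⟨fun h => hv (Set.mem_iUnion.2 ⟨_, h⟩), ?_⟩⟩
  exact ⟨x, lscaIter_monotone E U (le_max_left i j) hi,
    y, lscaIter_monotone E U (le_max_right i j) hj, hxy⟩

theorem subset_lscaClosure {V : Type} (E : V → V → Prop) (U : Set V) : U ⊆ lscaClosure E U :=
  Set.subset_iUnion (lscaIter E U) 0

/-- Let `G = (V, E)` be a finite DAG, `Y ∈ V`, and let `B` be
a proper ancestor of `Y` with `B ∉ L∞(Pa(Y))`.  Then there is exactly one node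
`Z ∈ L∞(Pa(Y))` such that there exists a non-trivial path from `B` to `Z` none
of whose nodes other than `Z` lies in `L∞(Pa(Y))`. -/
theorem existsUnique_connector_of_ancestor {V : Type} [Fintype V] (E : V → V → Prop)
    (hacy : Acyclic E) (Y B : V)
    (hBanc : B ∈ An E Y) (hBY : B ≠ Y)
    (hB : B ∉ lscaClosure E (Pa E Y)) :
    ∃! Z : V, Z ∈ lscaClosure E (Pa E Y) ∧
      ∃ p : List V, IsPath E B Z p ∧ 2 ≤ p.length ∧
        ∀ w ∈ p, w ≠ Z → w ∉ lscaClosure E (Pa E Y) := by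
  have hpath : ∀ Z, (Z ∈ lscaClosure E (Pa E Y) ∧
      ∃ p : List V, IsPath E B Z p ∧ 2 ≤ p.length ∧
        ∀ w ∈ p, w ≠ Z → w ∉ lscaClosure E (Pa E Y)) ↔
      Connects E (lscaClosure E (Pa E Y)) B Z := fun Z => by
    refine and_congr_right fun hZ => ?_
    rw [← exists_isPath_forall_ne_iff]
    refine exists_congr fun p => and_congr_right fun hp => and_iff_right ?_
    match p, hp with
    | [], hp => simp [IsPath] at hp
    | [a], ⟨_, hhead, hlast⟩ =>
      obtain rfl : a = B := by simpa using hhead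
      obtain rfl : a = Z := by simpa using hlast
      exact absurd hZ hB
    | _ :: _ :: _, _ => simp
  simp only [hpath]
  obtain ⟨P, hBP, hPY⟩ : ∃ P, Relation.ReflTransGen E B P ∧ E P Y :=
    (Relation.ReflTransGen.cases_tail hBanc).resolve_left hBY.symm
  obtain ⟨Z, hZ, -⟩ := Connects.exists_of_reflTransGen (E := E) (fun _ _ h => h) hBP
    (subset_lscaClosure E (Pa E Y) hPY)
  exact ⟨Z, hZ, fun Z' hZ' => hZ'.unique hacy (LSCAset_lscaClosure_subset E _) hZ⟩
end

section
/- Let G = (V, E) be a finite DAG, U ⊆ V, and v ∈ V. If v' is a U-connector of v, i.e., v' ∈ De(v) ∩ L∞(U) and no element of De(v) ∩ L∞(U) other than v' is an ancestor of v', then there exists a path from v to v' that is uninterrupted by L∞(U). -/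
open scoped Classical

/-- A descendant is joined by a path all of whose nodes lie between its endpoints. -/
theorem exists_isPath_of_mem_De {V : Type} {E : V → V → Prop} {a b : V} (h : b ∈ De E a) :
    ∃ p : List V, IsPath E a b p ∧ ∀ w ∈ p, w ∈ De E a ∧ w ∈ An E b := by
  induction (show Relation.ReflTransGen E a b from h) using
    Relation.ReflTransGen.head_induction_on with
  | refl =>
    refine ⟨[b], ⟨List.isChain_singleton b, rfl, rfl⟩, fun w hw => ?_⟩
    obtain rfl := List.mem_singleton.1 hw
    exact ⟨.refl, .refl⟩
  | @head a c hac hcb ih =>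
    obtain ⟨p, ⟨hp, hhead, hlast⟩, hmem⟩ := ih hcb
    refine ⟨a :: p, ⟨List.isChain_cons.2 ⟨fun y hy => ?_, hp⟩, rfl, ?_⟩, fun w hw => ?_⟩
    · rw [hhead] at hy
      cases hy
      exact hac
    · simp [List.getLast?_cons, hlast]
    · rcases List.mem_cons.1 hw with rfl | hw
      · exact ⟨.refl, .head hac hcb⟩
      · exact ⟨.head hac (hmem w hw).1, (hmem w hw).2⟩

/-- Let `G = (V, E)` be a finite DAG, `U ⊆ V`, and `v ∈ V`.
If `v'` is a `U`-connector of `v`, i.e. `v' ∈ De(v) ∩ L∞(U)` and no element of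
`De(v) ∩ L∞(U)` other than `v'` is an ancestor of `v'`, then there exists a
path from `v` to `v'` that is uninterrupted by `L∞(U)` (its only node in
`L∞(U)` is the endpoint `v'`). -/
theorem connector_has_uninterrupted_path {V : Type} [Fintype V] (E : V → V → Prop)
    (hacy : Acyclic E) (U : Set V) (v v' : V)
    (hde : v' ∈ De E v) (hcl : v' ∈ lscaClosure E U)
    (hmax : ∀ w : V, w ∈ De E v → w ∈ lscaClosure E U → w ≠ v' → w ∉ An E v') :
    ∃ p : List V, IsPath E v v' p ∧ ∀ w ∈ p, w ∈ lscaClosure E U → w = v' := by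
  obtain ⟨p, hp, hmem⟩ := exists_isPath_of_mem_De hde
  refine ⟨p, hp, fun w hw hwU => ?_⟩
  by_contra hne
  exact hmax w (hmem w hw).1 hwU hne (hmem w hw).2
end

section
/- Let G = (V, E) be a finite DAG, fix an SCM over G, and let B, Z, Y ∈ V be such that every path from B to Y in G contains Z. Then for every b ∈ R_B and every unit n, the blocked unrolled assignments chain: f̄_Y[B](b, n) = f̄_Y[Z](f̄_Z[B](b, n), n). -/
open scoped Classical

/-- The number of strict ancestors of a node. -/
noncomputable def strictAncestorCount {V : Type} (E : V → V → Prop) (v : V) : ℕ :=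
  {u | Relation.TransGen E u v}.ncard

theorem strictAncestorCount_lt_of_edge {V : Type} [Finite V] {E : V → V → Prop}
    (hacy : Acyclic E) {p v : V} (h : E p v) :
    strictAncestorCount E p < strictAncestorCount E v := by
  refine Set.ncard_lt_ncard ⟨fun u hu => Relation.TransGen.tail hu h, fun hsub => ?_⟩
    (Set.toFinite _)
  exact hacy p (hsub (Relation.TransGen.single h))

theorem strictAncestorCount_le_card {V : Type} [Fintype V] (E : V → V → Prop) (v : V) :
    strictAncestorCount E v ≤ Fintype.card V := by
  rw [← Nat.card_eq_fintype_card]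
  exact Set.ncard_le_card _

theorem approx_succ_of_lt {V : Type} [Finite V] {E : V → V → Prop} (hacy : Acyclic E)
    (scm : SCM V E) (n : ∀ v, scm.N v) (k : ℕ) (v : V) (hk : strictAncestorCount E v < k) :
    approx scm n (k + 1) v = approx scm n k v := by
  induction k generalizing v with
  | zero => omega
  | succ k ih =>
    change scm.f v (fun p => approx scm n (k + 1) p.1) (n v) =
      scm.f v (fun p => approx scm n k p.1) (n v)
    congr 1
    funext p
    have := strictAncestorCount_lt_of_edge hacy p.2
    exact ih p.1 (by omega)

/-- The unrolled assignment satisfies its defining recursion. -/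
theorem unroll_eq {V : Type} [Fintype V] {E : V → V → Prop} (hacy : Acyclic E)
    (scm : SCM V E) (n : ∀ v, scm.N v) (v : V) :
    unroll scm n v = scm.f v (fun p => unroll scm n p.1) (n v) := by
  have := strictAncestorCount_le_card E v
  exact (approx_succ_of_lt hacy scm n (Fintype.card V + 1) v (by omega)).symm

theorem blockApprox_succ_of_lt {V : Type} [Fintype V] {E : V → V → Prop} (hacy : Acyclic E)
    (scm : SCM V E) (B : V) (b : scm.R B) (n : ∀ v, scm.N v) (k : ℕ) (v : V)
    (hk : strictAncestorCount E v < k) :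
    blockApprox scm B b n (k + 1) v = blockApprox scm B b n k v := by
  induction k generalizing v with
  | zero => omega
  | succ k ih =>
    have hpar : (fun p : {p // E p v} => blockApprox scm B b n (k + 1) p.1) =
        (fun p : {p // E p v} => blockApprox scm B b n k p.1) := by
      funext p
      have := strictAncestorCount_lt_of_edge hacy p.2
      exact ih p.1 (by omega)
    simp only [blockApprox] at hpar ⊢
    rw [hpar]

theorem blockUnroll_self {V : Type} [Fintype V] {E : V → V → Prop} (scm : SCM V E)
    (B : V) (b : scm.R B) (n : ∀ v, scm.N v) : blockUnroll scm B b n B = b := by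
  simp [blockUnroll, blockApprox]

theorem blockUnroll_of_not_reachable {V : Type} [Fintype V] {E : V → V → Prop}
    (scm : SCM V E) (B : V) (b : scm.R B) (n : ∀ v, scm.N v) {v : V}
    (hv : ¬ Relation.ReflTransGen E B v) : blockUnroll scm B b n v = unroll scm n v := by
  have hne : v ≠ B := by
    rintro rfl
    exact hv Relation.ReflTransGen.refl
  simp [blockUnroll, blockApprox, hne, hv]

/-- The blocked unrolled assignment satisfies the unrolling recursion at every node other than the
blocked one, whether or not the node is a descendant of the blocked one. -/
theorem blockUnroll_of_ne {V : Type} [Fintype V] {E : V → V → Prop} (hacy : Acyclic E)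
    (scm : SCM V E) (B : V) (b : scm.R B) (n : ∀ v, scm.N v) {v : V} (hne : v ≠ B) :
    blockUnroll scm B b n v = scm.f v (fun p => blockUnroll scm B b n p.1) (n v) := by
  by_cases hv : Relation.ReflTransGen E B v
  · have := strictAncestorCount_le_card E v
    rw [blockUnroll, ← blockApprox_succ_of_lt hacy scm B b n _ v (by omega)]
    exact (dif_neg hne).trans (if_pos hv)
  · rw [blockUnroll_of_not_reachable scm B b n hv, unroll_eq hacy]
    congr 1
    funext p
    exact (blockUnroll_of_not_reachable scm B b n fun hp => hv (hp.tail p.2)).symm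

theorem isPath_singleton {V : Type} (E : V → V → Prop) (a : V) : IsPath E a a [a] :=
  ⟨List.isChain_singleton a, rfl, rfl⟩

theorem IsPath.append_edge {V : Type} {E : V → V → Prop} {a u v : V} {p : List V}
    (hp : IsPath E a u p) (h : E u v) : IsPath E a v (p ++ [v]) := by
  obtain ⟨hchain, hhead, hlast⟩ := hp
  refine ⟨List.isChain_append.2 ⟨hchain, List.isChain_singleton v, ?_⟩, ?_, by simp⟩
  · simp [hlast, h]
  · simp [List.head?_append, hhead]

/-- Let `G = (V, E)` be a finite DAG, fix an SCM over `G`,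
and let `B, Z, Y ∈ V` be such that every path from `B` to `Y` in `G` contains
`Z`.  Then for every `b ∈ R_B` and every unit `n`, the blocked unrolled
assignments chain: `f̄_Y[B](b, n) = f̄_Y[Z](f̄_Z[B](b, n), n)`. -/
theorem blockUnroll_chain {V : Type} [Fintype V] (E : V → V → Prop)
    (hacy : Acyclic E) (scm : SCM V E) (B Z Y : V)
    (hall : ∀ p : List V, IsPath E B Y p → Z ∈ p)
    (b : scm.R B) (n : ∀ v, scm.N v) :
    blockUnroll scm B b n Y = blockUnroll scm Z (blockUnroll scm B b n Z) n Y := by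
  induction hd : strictAncestorCount E Y using Nat.strong_induction_on generalizing Y with
  | _ d ih =>
    by_cases hYZ : Y = Z
    · subst hYZ
      rw [blockUnroll_self]
    · have hYB : Y ≠ B := by
        rintro rfl
        exact hYZ (List.mem_singleton.1 (hall _ (isPath_singleton E Y))).symm
      rw [blockUnroll_of_ne hacy scm B b n hYB, blockUnroll_of_ne hacy scm Z _ n hYZ]
      congr 1
      funext p
      refine ih _ (hd ▸ strictAncestorCount_lt_of_edge hacy p.2) p.1 (fun q hq => ?_) rfl
      rcases List.mem_append.1 (hall _ (hq.append_edge p.2)) with h | h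
      · exact h
      · exact absurd (List.mem_singleton.1 h).symm hYZ
end

section
/- Let G = (V, E) be a finite DAG, fix an SCM over G, let X ∈ V, let A ⊆ V \ De(X) be a set of nodes, and let g : (∏_{a ∈ A} R_a) → R_X be a policy. Then for every Y ∈ V and every unit n, the unrolled assignment of Y after the conditional intervention do(X = g(A)) coincides with the unrolled assignment of Y after the atomic intervention that sets X to the value g applied to the observational values of A: f̄_Y^{do(X=g(A))}(n) = f̄_Y^{do(X = g((f̄_a(n))_{a ∈ A}))}(n). -/
open scoped Classical

/-- The number of proper ancestors of a node. -/
noncomputable def ancestorCount {V : Type} (E : V → V → Prop) (v : V) : ℕ :=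
  {u | Relation.TransGen E u v}.ncard

theorem ancestorCount_lt_of_edge {V : Type} [Finite V] {E : V → V → Prop} (hacy : Acyclic E)
    {p v : V} (h : E p v) : ancestorCount E p < ancestorCount E v :=
  Set.ncard_lt_ncard
    ⟨fun _ hu => hu.tail h, fun hsub => hacy p (hsub (Relation.TransGen.single h))⟩

theorem ancestorCount_le_card {V : Type} [Fintype V] (E : V → V → Prop) (v : V) :
    ancestorCount E v ≤ Fintype.card V := by
  rw [← Nat.card_eq_fintype_card]
  exact Set.ncard_le_card _

theorem Acyclic.wellFounded {V : Type} [Finite V] {E : V → V → Prop} (hacy : Acyclic E) :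
    WellFounded E :=
  Subrelation.wf (fun h => ancestorCount_lt_of_edge hacy h) (measure (ancestorCount E)).wf

/-- The fuel-bounded approximations agree once the fuel exceeds the number of proper ancestors. -/
theorem approx_eq_approx {V : Type} [Finite V] {E : V → V → Prop} (hacy : Acyclic E)
    (scm : SCM V E) (n : ∀ v, scm.N v) {k m : ℕ} {v : V}
    (hk : ancestorCount E v < k) (hm : ancestorCount E v < m) :
    approx scm n k v = approx scm n m v := by
  induction k generalizing m v with
  | zero => omega
  | succ k ih =>
    obtain _ | m := m
    · omega
    · have hp : (fun p : {p // E p v} => approx scm n k p.1) = fun p : {p // E p v} => approx scm n m p.1 := by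
        funext p
        have := ancestorCount_lt_of_edge hacy p.2
        exact ih (by omega) (by omega)
      simp only [approx, hp]

theorem transGen_condE {V : Type} {E : V → V → Prop} {X : V} {A : Set V}
    (hA : ∀ a ∈ A, a ∉ De E X) {u v : V} (h : Relation.TransGen (condE E X A) u v) :
    Relation.TransGen E u v ∨
      ∃ a ∈ A, Relation.ReflTransGen E u a ∧ Relation.ReflTransGen E X v := by
  induction h with
  | single h =>
    rcases h with ⟨rfl, ha⟩ | ⟨-, h⟩
    · exact Or.inr ⟨u, ha, .refl, .refl⟩
    · exact Or.inl (.single h)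
  | tail _ h ih =>
    rcases h with ⟨rfl, ha⟩ | ⟨-, h⟩
    · rcases ih with ih | ⟨_, _, _, hX⟩
      · exact Or.inr ⟨_, ha, ih.to_reflTransGen, .refl⟩
      · exact absurd hX (hA _ ha)
    · rcases ih with ih | ⟨a, ha, hu, hX⟩
      · exact Or.inl (ih.tail h)
      · exact Or.inr ⟨a, ha, hu, hX.tail h⟩

theorem Acyclic.condE {V : Type} {E : V → V → Prop} (hacy : Acyclic E) {X : V} {A : Set V}
    (hA : ∀ a ∈ A, a ∉ De E X) : Acyclic (condE E X A) := by
  intro v hv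
  rcases transGen_condE hA hv with h | ⟨a, ha, hva, hXv⟩
  · exact hacy v h
  · exact hA a ha (hXv.trans hva)

theorem unroll_intervene_self {V : Type} [Fintype V] {E : V → V → Prop} (hacy : Acyclic E)
    (scm : SCM V E) (X : V) (x : scm.R X) (n : ∀ v, scm.N v) :
    unroll (scm.intervene X x) n X = x := by
  have hf : (scm.intervene X x).f X = fun _ _ => x := dif_pos rfl
  exact (unroll_eq hacy (scm.intervene X x) n X).trans (congrFun (congrFun hf _) _)

theorem unroll_intervene_of_ne {V : Type} [Fintype V] {E : V → V → Prop} (hacy : Acyclic E)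
    (scm : SCM V E) (X : V) (x : scm.R X) (n : ∀ v, scm.N v) {v : V} (hv : v ≠ X) :
    unroll (scm.intervene X x) n v =
      scm.f v (fun p => unroll (scm.intervene X x) n p.1) (n v) :=
  (unroll_eq hacy (scm.intervene X x) n _).trans
    (congrFun (congrFun (dif_neg hv) _) _)

/-- An atomic intervention on `X` does not affect non-descendants of `X`. -/
theorem unroll_intervene_of_notMem_De {V : Type} [Fintype V] {E : V → V → Prop}
    (hacy : Acyclic E) (scm : SCM V E) (X : V) (x : scm.R X) (n : ∀ v, scm.N v) {v : V}
    (hv : v ∉ De E X) : unroll (scm.intervene X x) n v = unroll scm n v := by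
  induction v using hacy.wellFounded.induction with
  | _ v ih =>
    have hne : v ≠ X := by
      rintro rfl
      exact hv Relation.ReflTransGen.refl
    rw [unroll_intervene_of_ne hacy scm X x n hne, unroll_eq hacy scm]
    congr 1
    funext p
    exact ih p.1 p.2 fun hp => hv (Relation.ReflTransGen.tail hp p.2)

theorem unroll_condIntervene_self {V : Type} [Fintype V] {E : V → V → Prop} (hacy : Acyclic E)
    (scm : SCM V E) {X : V} {A : Set V} (hA : ∀ a ∈ A, a ∉ De E X)
    (g : (∀ a : A, scm.R a.1) → scm.R X) (n : ∀ v, scm.N v) :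
    unroll (scm.condIntervene X A g) n X =
      g (fun a => unroll (scm.condIntervene X A g) n a.1) :=
  (unroll_eq (hacy.condE hA) (scm.condIntervene X A g) n _).trans (dif_pos rfl)

theorem unroll_condIntervene_of_ne {V : Type} [Fintype V] {E : V → V → Prop} (hacy : Acyclic E)
    (scm : SCM V E) {X : V} {A : Set V} (hA : ∀ a ∈ A, a ∉ De E X)
    (g : (∀ a : A, scm.R a.1) → scm.R X) (n : ∀ v, scm.N v) {v : V} (hv : v ≠ X) :
    unroll (scm.condIntervene X A g) n v =
      scm.f v (fun p => unroll (scm.condIntervene X A g) n p.1) (n v) :=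
  (unroll_eq (hacy.condE hA) (scm.condIntervene X A g) n _).trans (dif_neg hv)

/-- Let `G = (V, E)` be a finite DAG, fix an SCM over `G`,
let `X ∈ V`, let `A ⊆ V \ De(X)`, and let `g : (∏_{a ∈ A} R_a) → R_X` be a
policy.  Then for every `Y ∈ V` and every unit `n`, the unrolled assignment of
`Y` after the conditional intervention `do(X = g(A))` coincides with the
unrolled assignment of `Y` after the atomic intervention that sets `X` to the
value `g` applied to the observational values of `A`:
`f̄_Y^{do(X=g(A))}(n) = f̄_Y^{do(X = g((f̄_a(n))_{a ∈ A}))}(n)`. -/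
theorem condIntervene_unroll_eq_intervene_unroll {V : Type} [Fintype V]
    (E : V → V → Prop) (hacy : Acyclic E) (scm : SCM V E) (X : V) (A : Set V)
    (hA : ∀ a ∈ A, a ∉ De E X)
    (g : (∀ a : A, scm.R a.1) → scm.R X) (Y : V) (n : ∀ v, scm.N v) :
    unroll (scm.condIntervene X A g) n Y =
      unroll (scm.intervene X (g (fun a => unroll scm n a.1))) n Y := by
  induction Y using (hacy.condE hA).wellFounded.induction with
  | _ v ih =>
    by_cases hv : v = X
    · subst hv
      rw [unroll_condIntervene_self hacy scm hA, unroll_intervene_self hacy]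
      congr 1
      funext a
      exact (ih a.1 (Or.inl ⟨rfl, a.2⟩)).trans
        (unroll_intervene_of_notMem_De hacy scm v _ n (hA a.1 a.2))
    · rw [unroll_condIntervene_of_ne hacy scm hA g n hv, unroll_intervene_of_ne hacy scm X _ n hv]
      congr 1
      funext p
      exact ih p.1 (Or.inr ⟨hv, p.2⟩)
end
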